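/- Let ν : [0,∞) × 𝕊¹ → [0,∞) be smooth with ν(0,θ) = 0 and ∂ν/∂r(0,θ) = 1 for every θ, ν(r,θ) > 0 for r > 0, and ∂²ν/∂r² ≥ 0 everywhere (this is the condition that the surface with metric dr² + ν²(r,θ)dθ² in geodesic polar coordinates is Cartan–Hadamard, since its Gauss curvature equals −ν^{-1} ∂²ν/∂r²). Let σ : [0,∞) → [0,∞) be of hyperbolic type. Fix R̄ > 0. Then for every R > R̄ there exist k ≥ 1 and a smooth function τ : [0,∞) × 𝕊¹ → [0,∞) such that: τ(r,θ) = ν(r,θ) for all r ∈ [0,R̄] and θ ∈ 𝕊¹; τ(r,θ) = σ_k(r) for all r ∈ [R,∞) and θ ∈ 𝕊¹; ∂²τ/∂r² ≥ 0 everywhere; and ∂τ/∂r ≥ 1 everywhere, where σ_k(r) := k^{-1/2} σ(k^{1/2} r). -/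

import Mathlib

/-- The rescaled warping function `σ_k(r) = k^{-1/2} σ(k^{1/2} r)`. -/
noncomputable def sigmaK (σ : ℝ → ℝ) (k r : ℝ) : ℝ :=
  (Real.sqrt k)⁻¹ * σ (Real.sqrt k * r)

/-- A smooth function `σ : [0,∞) → [0,∞)` is of *hyperbolic type*. -/
def IsHyperbolicType (σ : ℝ → ℝ) : Prop :=
  ContDiff ℝ (⊤ : ℕ∞) σ ∧ σ 0 = 0 ∧ deriv σ 0 = 1 ∧
    (∀ j : ℕ, iteratedDeriv (2 * j) σ 0 = 0) ∧
    (∀ r : ℝ, 0 < r → 0 < σ r) ∧ (∀ r : ℝ, 0 ≤ r → 0 ≤ σ r) ∧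
    (∀ r : ℝ, 0 ≤ r → 0 ≤ iteratedDeriv 2 σ r) ∧
    (∀ k : ℝ, 1 ≤ k → ∀ r : ℝ, 0 < r → sigmaK σ k r ≤ deriv (sigmaK σ k) r) ∧
    (∀ r : ℝ, 0 < r → Filter.Tendsto (fun k : ℝ => sigmaK σ k r) Filter.atTop Filter.atTop)

open Set Filter Topology

lemma sub_le_sub_of_hasDerivAt_le {G H g h : ℝ → ℝ} {x y : ℝ}
    (hG : ∀ t, HasDerivAt G (g t) t) (hH : ∀ t, HasDerivAt H (h t) t)
    (hxy : x ≤ y) (hgh : ∀ t ∈ Icc x y, g t ≤ h t) : G y - G x ≤ H y - H x := by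
  have hd : ∀ t, HasDerivAt (fun t => H t - G t) (h t - g t) t := fun t => (hH t).sub (hG t)
  have hmono : MonotoneOn (fun t => H t - G t) (Icc x y) := by
    refine monotoneOn_of_deriv_nonneg (convex_Icc x y)
      (fun t _ => (hd t).continuousAt.continuousWithinAt)
      (fun t _ => (hd t).differentiableAt.differentiableWithinAt) fun t ht => ?_
    rw [(hd t).deriv]
    linarith [hgh t (interior_subset ht)]
  have := hmono (left_mem_Icc.2 hxy) (right_mem_Icc.2 hxy) hxy
  simp only at this
  linarith

lemma exists_smooth_antideriv {g : ℝ → ℝ} (hg : ContDiff ℝ (⊤ : ℕ∞) g) (a : ℝ) :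
    ∃ G : ℝ → ℝ, ContDiff ℝ (⊤ : ℕ∞) G ∧ G a = 0 ∧ ∀ x, HasDerivAt G (g x) x := by
  have hd : ∀ x, HasDerivAt (fun x => ∫ t in a..x, g t) (g x) x := fun x =>
    hg.continuous.integral_hasStrictDerivAt a x |>.hasDerivAt
  refine ⟨fun x => ∫ t in a..x, g t, ?_, by simp, hd⟩
  rw [contDiff_infty_iff_deriv]
  refine ⟨fun x => (hd x).differentiableAt, ?_⟩
  rwa [funext fun x => (hd x).deriv]

lemma hasDerivAt_of_smooth {f : ℝ → ℝ} (hf : ContDiff ℝ (⊤ : ℕ∞) f) (x : ℝ) :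
    HasDerivAt f (deriv f x) x :=
  (hf.differentiable (by simp) x).hasDerivAt

lemma smooth_deriv {f : ℝ → ℝ} (hf : ContDiff ℝ (⊤ : ℕ∞) f) :
    ContDiff ℝ (⊤ : ℕ∞) (deriv f) :=
  (contDiff_infty_iff_deriv.1 hf).2

lemma iteratedDeriv_two_eq (f : ℝ → ℝ) : iteratedDeriv 2 f = deriv (deriv f) := by
  rw [iteratedDeriv_succ, iteratedDeriv_one]

lemma one_le_deriv_of_convex {f : ℝ → ℝ} (hf : ContDiff ℝ (⊤ : ℕ∞) f) (h1 : deriv f 0 = 1)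
    (hf2 : ∀ r, 0 ≤ r → 0 ≤ deriv (deriv f) r) {r : ℝ} (hr : 0 ≤ r) : 1 ≤ deriv f r := by
  have := sub_le_sub_of_hasDerivAt_le (fun t => hasDerivAt_const t (0 : ℝ))
    (hasDerivAt_of_smooth (smooth_deriv hf)) hr fun t ht => hf2 t ht.1
  linarith

/-- A smooth convex version of the positive part. -/
lemma exists_smooth_posPart : ∃ (m : ℝ → ℝ) (c : ℝ), ContDiff ℝ (⊤ : ℕ∞) m ∧ c ≤ 1 ∧
    (∀ t, 0 ≤ m t) ∧ (∀ t ≤ 0, m t = 0) ∧ (∀ t, 1 ≤ t → m t = t - c) ∧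
    (∀ t, 0 ≤ deriv m t) ∧ (∀ t, deriv m t ≤ 1) ∧ (∀ t, 0 ≤ deriv (deriv m) t) := by
  obtain ⟨m, hm, hm0, hd⟩ := exists_smooth_antideriv (Real.smoothTransition.contDiff (n := ⊤)) 0
  have hm' : deriv m = Real.smoothTransition := funext fun t => (hd t).deriv
  have hneg : ∀ t ≤ 0, m t = 0 := by
    intro t ht
    have h0 := fun s : ℝ => hasDerivAt_const s (0 : ℝ)
    have hS : ∀ s ∈ Icc t 0, Real.smoothTransition s = 0 := fun s hs =>
      Real.smoothTransition.zero_of_nonpos hs.2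
    have h1 := sub_le_sub_of_hasDerivAt_le hd h0 ht fun s hs => (hS s hs).le
    have h2 := sub_le_sub_of_hasDerivAt_le h0 hd ht fun s hs => (hS s hs).ge
    linarith
  have hpos : ∀ t, 0 ≤ t → 0 ≤ m t := by
    intro t ht
    have := sub_le_sub_of_hasDerivAt_le (fun s : ℝ => hasDerivAt_const s (0 : ℝ)) hd ht
      fun s _ => Real.smoothTransition.nonneg s
    linarith
  refine ⟨m, 1 - m 1, hm, by linarith [hpos 1 zero_le_one], ?_, hneg, ?_, ?_, ?_, ?_⟩
  · intro t
    rcases le_total t 0 with h | h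
    · exact (hneg t h).ge
    · exact hpos t h
  · intro t ht
    have hS : ∀ s ∈ Icc 1 t, Real.smoothTransition s = 1 := fun s hs =>
      Real.smoothTransition.one_of_one_le hs.1
    have h1 := sub_le_sub_of_hasDerivAt_le hd hasDerivAt_id ht fun s hs => (hS s hs).le
    have h2 := sub_le_sub_of_hasDerivAt_le hasDerivAt_id hd ht fun s hs => (hS s hs).ge
    simp only [id] at h1 h2
    linarith
  · intro t
    rw [hm']
    exact Real.smoothTransition.nonneg t
  · intro t
    rw [hm']
    exact Real.smoothTransition.le_one t
  · intro t
    rw [hm']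
    exact Real.smoothTransition.monotone.deriv_nonneg

/-- A convex smooth function can be straightened to the left of `p` without changing it to the
right of `q > p`. -/
lemma exists_straightening {s : ℝ → ℝ} (hs : ContDiff ℝ (⊤ : ℕ∞) s)
    (hs2 : ∀ r, 0 ≤ r → 0 ≤ deriv (deriv s) r) {p q : ℝ} (hp : 0 ≤ p) (hpq : p < q) :
    ∃ B : ℝ → ℝ, ContDiff ℝ (⊤ : ℕ∞) B ∧ (∀ r, q ≤ r → B r = s r) ∧
      (∀ r, 0 ≤ r → 0 ≤ deriv (deriv B) r) ∧ (∀ r, 0 ≤ r → deriv s r ≤ deriv B r) ∧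
      (∀ r ∈ Icc 0 p, B r ≤ s p - deriv s p * (p - r)) := by
  set χ : ℝ → ℝ := fun r => Real.smoothTransition ((r - p) / (q - p))
  have hqp : 0 < q - p := sub_pos.2 hpq
  have hχs : ContDiff ℝ (⊤ : ℕ∞) χ :=
    (Real.smoothTransition.contDiff (n := ⊤)).comp
      ((contDiff_id.sub contDiff_const).div_const _)
  have hχ0 : ∀ r ≤ p, χ r = 0 := fun r hr =>
    Real.smoothTransition.zero_of_nonpos (div_nonpos_of_nonpos_of_nonneg (by linarith) hqp.le)
  have hχ1 : ∀ r, q ≤ r → χ r = 1 := fun r hr =>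
    Real.smoothTransition.one_of_one_le ((one_le_div hqp).2 (by linarith))
  have hχnn : ∀ r, 0 ≤ χ r := fun r => Real.smoothTransition.nonneg _
  have hχle : ∀ r, χ r ≤ 1 := fun r => Real.smoothTransition.le_one _
  have hs' := smooth_deriv hs
  have hs'' := smooth_deriv hs'
  have hc := fun t : ℝ => hasDerivAt_const t (0 : ℝ)
  obtain ⟨e, he, heq, hed⟩ :=
    exists_smooth_antideriv ((contDiff_const (c := (1 : ℝ))).sub hχs |>.mul hs'') q
  obtain ⟨E, hE, hEq, hEd⟩ := exists_smooth_antideriv he q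
  have hdd : ∀ r, 0 ≤ r → 0 ≤ (1 - χ r) * deriv (deriv s) r := fun r hr =>
    mul_nonneg (sub_nonneg.2 (hχle r)) (hs2 r hr)
  have he_right : ∀ r, q ≤ r → e r = 0 := by
    intro r hr
    have h0 : ∀ t ∈ Icc q r, (1 - χ t) * deriv (deriv s) t = 0 := fun t ht => by
      rw [hχ1 t ht.1]; ring
    have h1 := sub_le_sub_of_hasDerivAt_le hed hc hr fun t ht => (h0 t ht).le
    have h2 := sub_le_sub_of_hasDerivAt_le hc hed hr fun t ht => (h0 t ht).ge
    linarith
  have hE_right : ∀ r, q ≤ r → E r = 0 := by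
    intro r hr
    have h1 := sub_le_sub_of_hasDerivAt_le hEd hc hr fun t ht => (he_right t ht.1).le
    have h2 := sub_le_sub_of_hasDerivAt_le hc hEd hr fun t ht => (he_right t ht.1).ge
    linarith
  have he_nonpos : ∀ r, 0 ≤ r → e r ≤ 0 := by
    intro r hr
    rcases le_total q r with h | h
    · exact (he_right r h).le
    · have := sub_le_sub_of_hasDerivAt_le hc hed h fun t ht => hdd t (hr.trans ht.1)
      linarith
  have hEp : 0 ≤ E p := by
    have := sub_le_sub_of_hasDerivAt_le hEd hc hpq.le fun t ht => he_nonpos t (hp.trans ht.1)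
    linarith
  have hBd : ∀ r, HasDerivAt (fun r => s r - E r) (deriv s r - e r) r := fun r =>
    (hasDerivAt_of_smooth hs r).sub (hEd r)
  have hBd' : deriv (fun r => s r - E r) = fun r => deriv s r - e r :=
    funext fun r => (hBd r).deriv
  have hBdd : ∀ r, HasDerivAt (fun r => deriv s r - e r) (χ r * deriv (deriv s) r) r := by
    intro r
    refine ((hasDerivAt_of_smooth hs' r).sub (hed r)).congr_deriv ?_
    ring
  refine ⟨fun r => s r - E r, hs.sub hE, ?_, ?_, ?_, ?_⟩
  · intro r hr
    simp [hE_right r hr]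
  · intro r hr
    rw [hBd', (hBdd r).deriv]
    exact mul_nonneg (hχnn r) (hs2 r hr)
  · intro r hr
    rw [hBd']
    linarith [he_nonpos r hr]
  · intro r hr
    have hslope : ∀ t ∈ Icc r p, deriv s p ≤ deriv s t - e t := by
      intro t ht
      have := sub_le_sub_of_hasDerivAt_le hBdd hc ht.2 fun u hu => by simp [hχ0 u hu.2]
      linarith [he_nonpos p hp]
    have := sub_le_sub_of_hasDerivAt_le
      (fun t => (hasDerivAt_id t).const_mul (deriv s p)) hBd hr.2 (by simpa using hslope)
    simp only [id] at this
    linarith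

/-- Convexity and slope bounds of the smooth maximum `f + m (b + c - f)`. -/
lemma smoothMax_deriv_bounds {f b m : ℝ → ℝ} (c : ℝ) (hf : ContDiff ℝ (⊤ : ℕ∞) f)
    (hb : ContDiff ℝ (⊤ : ℕ∞) b) (hm : ContDiff ℝ (⊤ : ℕ∞) m)
    (hm0 : ∀ t, 0 ≤ deriv m t) (hm1 : ∀ t, deriv m t ≤ 1) (hm2 : ∀ t, 0 ≤ deriv (deriv m) t)
    {r : ℝ} (hf1 : 1 ≤ deriv f r) (hb1 : 1 ≤ deriv b r)
    (hf2 : 0 ≤ deriv (deriv f) r) (hb2 : 0 ≤ deriv (deriv b) r) :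
    1 ≤ deriv (fun s => f s + m (b s + c - f s)) r ∧
      0 ≤ deriv (deriv (fun s => f s + m (b s + c - f s))) r := by
  have hu : ∀ s, HasDerivAt (fun s => b s + c - f s) (deriv b s - deriv f s) s := fun s =>
    ((hasDerivAt_of_smooth hb s).add_const c).sub (hasDerivAt_of_smooth hf s)
  have h1 : deriv (fun s => f s + m (b s + c - f s)) =
      fun s => deriv f s + deriv m (b s + c - f s) * (deriv b s - deriv f s) :=
    funext fun s => ((hasDerivAt_of_smooth hf s).add
      ((hasDerivAt_of_smooth hm _).comp s (hu s))).deriv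
  have h2 := (hasDerivAt_of_smooth (smooth_deriv hf) r).add
    (((hasDerivAt_of_smooth (smooth_deriv hm) _).comp r (hu r)).mul
      ((hasDerivAt_of_smooth (smooth_deriv hb) r).sub
        (hasDerivAt_of_smooth (smooth_deriv hf) r)))
  have a0 := hm0 (b r + c - f r)
  have a1 := hm1 (b r + c - f r)
  have a2 := hm2 (b r + c - f r)
  rw [h1]
  constructor
  · dsimp only
    nlinarith [mul_nonneg a0 (sub_nonneg.2 hb1),
      mul_nonneg (sub_nonneg.2 a1) (sub_nonneg.2 hf1)]
  · refine le_of_le_of_eq ?_ h2.deriv.symm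
    simp only [Pi.sub_apply, Function.comp_apply]
    nlinarith [mul_nonneg a0 hb2, mul_nonneg (sub_nonneg.2 a1) hf2,
      mul_nonneg a2 (sq_nonneg (deriv b r - deriv f r))]

lemma contDiff_sigmaK {σ : ℝ → ℝ} (hσ : ContDiff ℝ (⊤ : ℕ∞) σ) (k : ℝ) :
    ContDiff ℝ (⊤ : ℕ∞) (sigmaK σ k) :=
  contDiff_const.mul (hσ.comp (contDiff_const.mul contDiff_id))

lemma deriv_sigmaK {σ : ℝ → ℝ} (hσ : ContDiff ℝ (⊤ : ℕ∞) σ) {k : ℝ} (hk : 0 < k) :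
    deriv (sigmaK σ k) = fun r => deriv σ (√k * r) := by
  have hk' : √k ≠ 0 := (Real.sqrt_pos.2 hk).ne'
  funext r
  have h := ((hasDerivAt_of_smooth hσ (√k * r)).comp r
    ((hasDerivAt_id r).const_mul (√k))).const_mul (√k)⁻¹
  refine Eq.trans h.deriv ?_
  field_simp

lemma deriv_deriv_sigmaK {σ : ℝ → ℝ} (hσ : ContDiff ℝ (⊤ : ℕ∞) σ) {k : ℝ} (hk : 0 < k) (r : ℝ) :
    deriv (deriv (sigmaK σ k)) r = deriv (deriv σ) (√k * r) * √k := by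
  rw [deriv_sigmaK hσ hk]
  have h := (hasDerivAt_of_smooth (smooth_deriv hσ) (√k * r)).comp r
    ((hasDerivAt_id r).const_mul (√k))
  refine Eq.trans h.deriv ?_
  ring

lemma exists_bound_of_periodic {ν : ℝ → ℝ → ℝ} (hν : Continuous (Function.uncurry ν))
    {T : ℝ} (hT : 0 < T) (hper : ∀ r θ, ν r (θ + T) = ν r θ) (R : ℝ) :
    ∃ C, ∀ r ∈ Icc 0 R, ∀ θ, ν r θ ≤ C := by
  obtain ⟨C, hC⟩ := ((isCompact_Icc (a := (0 : ℝ)) (b := R)).prod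
    (isCompact_Icc (a := (0 : ℝ)) (b := T))).bddAbove_image hν.continuousOn
  refine ⟨C, fun r hr θ => ?_⟩
  obtain ⟨φ, hφ, h⟩ := Function.Periodic.exists_mem_Ico₀ (hper r) hT θ
  rw [h]
  exact hC ⟨(r, φ), ⟨hr, hφ.1, hφ.2.le⟩, rfl⟩

/-- Gluing a `2`-dimensional Cartan–Hadamard warping function
`ν(r,θ)` (the circle `𝕊¹` being modelled by `2π`-periodicity in the variable `θ`) to a
rescaled hyperbolic-type warping function `σ_k` outside a large ball, keeping
`∂²τ/∂r² ≥ 0` (i.e. Gauss curvature `−ν⁻¹ ∂²ν/∂r² ≤ 0`) and `∂τ/∂r ≥ 1`. -/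
theorem gluing_warping_functions_dim_two (ν : ℝ → ℝ → ℝ) (σ : ℝ → ℝ)
    (hνsmooth : ContDiff ℝ (⊤ : ℕ∞) (Function.uncurry ν))
    (hνper : ∀ r θ : ℝ, ν r (θ + 2 * Real.pi) = ν r θ)
    (hν0 : ∀ θ : ℝ, ν 0 θ = 0)
    (hν'0 : ∀ θ : ℝ, deriv (fun r => ν r θ) 0 = 1)
    (hνpos : ∀ r θ : ℝ, 0 < r → 0 < ν r θ)
    (hνconv : ∀ r θ : ℝ, 0 ≤ r → 0 ≤ iteratedDeriv 2 (fun s => ν s θ) r)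
    (hσ : IsHyperbolicType σ)
    (Rbar : ℝ) (hRbar : 0 < Rbar) :
    ∀ R : ℝ, Rbar < R → ∃ k : ℝ, 1 ≤ k ∧ ∃ τ : ℝ → ℝ → ℝ,
      ContDiff ℝ (⊤ : ℕ∞) (Function.uncurry τ) ∧
      (∀ r θ : ℝ, τ r (θ + 2 * Real.pi) = τ r θ) ∧
      (∀ θ : ℝ, ∀ r ∈ Set.Icc (0 : ℝ) Rbar, τ r θ = ν r θ) ∧
      (∀ θ r : ℝ, R ≤ r → τ r θ = sigmaK σ k r) ∧
      (∀ θ : ℝ, ∀ r : ℝ, 0 ≤ r → 0 ≤ iteratedDeriv 2 (fun s => τ s θ) r) ∧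
      (∀ θ : ℝ, ∀ r : ℝ, 0 ≤ r → 1 ≤ deriv (fun s => τ s θ) r) ∧
      (∀ θ : ℝ, ∀ r : ℝ, 0 ≤ r → 0 ≤ τ r θ) := by
  intro R hR
  obtain ⟨hσs, -, hσ1, -, -, hσnn, hσ2, hσgrow, hσlim⟩ := hσ
  obtain ⟨m, c, hm, hc1, hmnn, hmneg, hmbig, hm0, hm1, hm2⟩ := exists_smooth_posPart
  obtain ⟨p, hp, hpR⟩ := exists_between hR
  obtain ⟨q, hpq, hqR⟩ := exists_between hpR
  have hp0 : 0 < p := hRbar.trans hp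
  have hq0 : 0 < q := hp0.trans hpq
  obtain ⟨C, hC⟩ := exists_bound_of_periodic hνsmooth.continuous Real.two_pi_pos hνper R
  obtain ⟨k, hk1, hkq, hkp, hkslope⟩ := ((eventually_ge_atTop (1 : ℝ)).and
    (((hσlim q hq0).eventually_ge_atTop (C + 1 - c)).and
      (((hσlim p hp0).eventually_ge_atTop 1).and
        ((Real.tendsto_sqrt_atTop.atTop_mul_const
          (sub_pos.2 hp)).eventually_ge_atTop 2)))).exists
  have hk0 : 0 < k := zero_lt_one.trans_le hk1
  have hsk : 0 < √k := Real.sqrt_pos.2 hk0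
  have hs := contDiff_sigmaK hσs k
  have hs2 : ∀ r, 0 ≤ r → 0 ≤ deriv (deriv (sigmaK σ k)) r := by
    intro r hr
    rw [deriv_deriv_sigmaK hσs hk0]
    refine mul_nonneg ?_ hsk.le
    rw [← iteratedDeriv_two_eq]
    exact hσ2 _ (by positivity)
  have hs1 : ∀ r, 0 ≤ r → 1 ≤ deriv (sigmaK σ k) r := fun r hr =>
    one_le_deriv_of_convex hs (by rw [deriv_sigmaK hσs hk0]; simpa using hσ1) hs2 hr
  have hsnn : ∀ r, 0 ≤ r → 0 ≤ sigmaK σ k r := fun r hr =>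
    mul_nonneg (inv_nonneg.2 hsk.le) (hσnn _ (by positivity))
  -- the inequality at `k = 1` self-improves by scaling
  have hgrow : √k * sigmaK σ k p ≤ deriv (sigmaK σ k) p := by
    have h := hσgrow 1 le_rfl (√k * p) (by positivity)
    rw [deriv_sigmaK hσs one_pos] at h
    rw [deriv_sigmaK hσs hk0]
    simpa [sigmaK, hsk.ne'] using h
  obtain ⟨B, hB, hBq, hB2, hB1, hBp⟩ := exists_straightening hs hs2 hp0.le hpq
  have hBlow : ∀ r ∈ Icc 0 Rbar, B r ≤ -1 := by
    intro r hr
    have h1 := hBp r ⟨hr.1, hr.2.trans hp.le⟩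
    have h2 : √k * sigmaK σ k p * (p - Rbar) ≤ deriv (sigmaK σ k) p * (p - r) :=
      mul_le_mul hgrow (by linarith [hr.2]) (by linarith) (by linarith [hs1 p hp0.le])
    nlinarith
  have hslice : ∀ θ, ContDiff ℝ (⊤ : ℕ∞) (fun r => ν r θ) := fun θ =>
    hνsmooth.comp (contDiff_id.prodMk contDiff_const)
  have hν2 : ∀ θ r, 0 ≤ r → 0 ≤ deriv (deriv fun s => ν s θ) r := fun θ r hr => by
    rw [← iteratedDeriv_two_eq]
    exact hνconv r θ hr
  have hν1 : ∀ θ r, 0 ≤ r → 1 ≤ deriv (fun s => ν s θ) r := fun θ r hr =>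
    one_le_deriv_of_convex (hslice θ) (hν'0 θ) (hν2 θ) hr
  have hνnn : ∀ r θ, 0 ≤ r → 0 ≤ ν r θ := fun r θ hr => by
    rcases hr.eq_or_lt with rfl | h
    · exact (hν0 θ).ge
    · exact (hνpos r θ h).le
  let F : ℝ → ℝ → ℝ := fun r θ => ν r θ + m (B r + c - ν r θ)
  let τ : ℝ → ℝ → ℝ := fun r θ => if r < R then F r θ else sigmaK σ k r
  have hτF : ∀ r θ, r < R → τ r θ = F r θ := fun r θ h => if_pos h
  have hτs : ∀ r θ, q ≤ r → τ r θ = sigmaK σ k r := by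
    intro r θ hr
    by_cases h : r < R
    · have hmono := sub_le_sub_of_hasDerivAt_le (fun t => hasDerivAt_const t (0 : ℝ))
        (hasDerivAt_of_smooth hs) hr fun t ht =>
          zero_le_one.trans (hs1 t (hq0.le.trans ht.1))
      have hνC := hC r ⟨hq0.le.trans hr, h.le⟩ θ
      rw [hτF r θ h]
      simp only [F]
      rw [hBq r hr, hmbig _ (by linarith)]
      ring
    · exact if_neg h
  have hevF : ∀ θ r, r < R → (fun s => τ s θ) =ᶠ[𝓝 r] fun s => F s θ := fun θ r h => by
    filter_upwards [Iio_mem_nhds h] with s hs using hτF s θ hs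
  have hevs : ∀ θ r, R ≤ r → (fun s => τ s θ) =ᶠ[𝓝 r] sigmaK σ k := fun θ r h => by
    filter_upwards [Ioi_mem_nhds (hqR.trans_le h)] with s hs using hτs s θ (le_of_lt hs)
  have hFbounds : ∀ θ r, 0 ≤ r → 1 ≤ deriv (fun s => F s θ) r ∧
      0 ≤ deriv (deriv fun s => F s θ) r := fun θ r hr =>
    smoothMax_deriv_bounds c (hslice θ) hB hm hm0 hm1 hm2 (hν1 θ r hr)
      ((hs1 r hr).trans (hB1 r hr)) (hν2 θ r hr) (hB2 r hr)
  refine ⟨k, hk1, τ, ?_, ?_, ?_, fun θ r hr => hτs r θ (hqR.le.trans hr), ?_, ?_, ?_⟩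
  · rw [contDiff_iff_contDiffAt]
    rintro ⟨r, θ⟩
    rcases lt_or_ge r R with h | h
    · have hBfst : ContDiff ℝ (⊤ : ℕ∞) fun x : ℝ × ℝ => B x.1 := hB.comp contDiff_fst
      have hF : ContDiff ℝ (⊤ : ℕ∞) (Function.uncurry F) :=
        hνsmooth.add (hm.comp ((hBfst.add contDiff_const).sub hνsmooth))
      refine hF.contDiffAt.congr_of_eventuallyEq ?_
      filter_upwards [continuous_fst.continuousAt.preimage_mem_nhds (Iio_mem_nhds h)] with x hx
        using hτF x.1 x.2 hx
    · have hsfst : ContDiff ℝ (⊤ : ℕ∞) fun x : ℝ × ℝ => sigmaK σ k x.1 := hs.comp contDiff_fst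
      refine hsfst.contDiffAt.congr_of_eventuallyEq ?_
      filter_upwards [continuous_fst.continuousAt.preimage_mem_nhds
        (Ioi_mem_nhds (hqR.trans_le h))] with x hx using hτs x.1 x.2 (le_of_lt hx)
  · intro r θ
    simp only [τ, F, hνper]
  · intro θ r hr
    rw [hτF r θ (hr.2.trans_lt hR)]
    simp only [F]
    rw [hmneg _ (by linarith [hBlow r hr, hνnn r θ hr.1]), add_zero]
  · intro θ r hr
    rw [iteratedDeriv_two_eq]
    rcases lt_or_ge r R with h | h
    · rw [(hevF θ r h).deriv.deriv_eq]
      exact (hFbounds θ r hr).2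
    · rw [(hevs θ r h).deriv.deriv_eq]
      exact hs2 r hr
  · intro θ r hr
    rcases lt_or_ge r R with h | h
    · rw [(hevF θ r h).deriv_eq]
      exact (hFbounds θ r hr).1
    · rw [(hevs θ r h).deriv_eq]
      exact hs1 r hr
  · intro θ r hr
    rcases lt_or_ge r R with h | h
    · rw [hτF r θ h]
      exact add_nonneg (hνnn r θ hr) (hmnn _)
    · rw [hτs r θ (hqR.le.trans h)]
      exact hsnn r hr
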